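/- arXiv:2211.10584 — 2 statements merged into one kernel-verified Lean document; each statement's English description precedes it below -/
import Mathlib

section
/- For every n ≥ 1 and every f ∈ Δ, the element q_n^*(f) lies in 2^{(n−ε(n)+2)/2}·Δ. -/
open MvPolynomial

noncomputable section

/-- `R = ℚ[p₁,p₃,p₅,…]`: the variable `X k` represents `p_{2k+1}`. -/
abbrev FockR : Type := MvPolynomial ℕ ℚ

/-- `Δ = ℤ₍₂₎[p₁, 2p₃, 4p₅, …]`: the smallest subring of `R` containing all constants
with odd denominator (i.e. the image of `ℤ₍₂₎`) and the elements `2^k p_{2k+1}`. -/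
def Delta : Subring FockR :=
  Subring.closure ({f | ∃ q : ℚ, Odd q.den ∧ f = C q} ∪
    {f | ∃ k : ℕ, f = (2 : FockR) ^ k * X k})

/-- `z_μ` (as a rational) for the partition with odd parts corresponding to the
exponent vector `d` (where `d k` is the multiplicity of the part `2k+1`). -/
def zExp (d : ℕ →₀ ℕ) : ℚ :=
  ∏ k ∈ d.support, ((2 * k + 1 : ℚ) ^ d k * (Nat.factorial (d k)))

/-- The bilinear form on `R` for which the monomials `p_μ` are orthogonal with
`⟨p_μ, p_μ⟩ = z_μ`. -/
def innerP (f g : FockR) : ℚ :=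
  ∑ d ∈ f.support, coeff d f * coeff d g * zExp d

/-- The exponent vector of `p_μ`: part `p = 2k+1` of `μ` contributes to the variable `X k`. -/
def toExp {n : ℕ} (μ : Nat.Partition n) : ℕ →₀ ℕ :=
  (μ.parts.map (fun p => Finsupp.single ((p - 1) / 2) 1)).sum

/-- `p_μ` as an element of `R`. -/
def pMu {n : ℕ} (μ : Nat.Partition n) : FockR := monomial (toExp μ) 1

/-- `z_μ` for a partition `μ`. -/
def zPart {n : ℕ} (μ : Nat.Partition n) : ℚ :=
  (μ.parts.dedup.map
    (fun k => (k : ℚ) ^ μ.parts.count k * (Nat.factorial (μ.parts.count k)))).prod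

/-- `q_n = Σ_{μ ⊢ n, odd parts} (2^{ℓ(μ)}/z_μ) p_μ`. -/
def qFun (n : ℕ) : FockR :=
  ∑ μ ∈ Nat.Partition.odds n, ((2 : ℚ) ^ (Multiset.card μ.parts) / zPart μ) • pMu μ

/-- The operator `p_μ^*` (composite of the `k·∂/∂p_k`), for a partition with exponent
vector `e`, given by its action on coefficients. -/
def pStar (e : ℕ →₀ ℕ) (f : FockR) : FockR :=
  ∑ d ∈ f.support,
    (coeff d f * ∏ k ∈ e.support, ((2 * k + 1 : ℚ) ^ e k * ((d k).descFactorial (e k)))) •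
      monomial (d - e) (1 : ℚ)

/-- `q_n^* = Σ_{μ ⊢ n, odd parts} (2^{ℓ(μ)}/z_μ) p_μ^*`. -/
def qStar (n : ℕ) (f : FockR) : FockR :=
  ∑ μ ∈ Nat.Partition.odds n, ((2 : ℚ) ^ (Multiset.card μ.parts) / zPart μ) • pStar (toExp μ) f

/-- `ε(n)`: 0 if `n` even, 1 if `n` odd. -/
def eps (n : ℕ) : ℕ := n % 2

/-- `a(n)`: the largest integer `m` with `m(m+1)/2 ≤ n`. -/
def aFun (n : ℕ) : ℕ := Nat.findGreatest (fun m => m * (m + 1) ≤ 2 * n) n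

def Z2 : Subring ℚ where
  carrier := {q | Odd q.den}
  mul_mem' := by
    intro a b ha hb
    exact Odd.of_dvd_nat (ha.mul hb) (Rat.mul_den_dvd a b)
  one_mem' := by simp
  add_mem' := by
    intro a b ha hb
    exact Odd.of_dvd_nat (ha.mul hb) (Rat.add_den_dvd a b)
  zero_mem' := by simp
  neg_mem' := by
    intro a ha
    simpa using ha

def wt : (ℕ →₀ ℕ) →+ ℕ := Finsupp.weight (fun k : ℕ => k)

lemma wt_single (k m : ℕ) : wt (Finsupp.single k m) = m * k := by
  simp [wt, Finsupp.weight_single]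

lemma C_two' : (C (2 : ℚ) : FockR) = 2 := map_ofNat C 2

lemma coeff_of_mem {f : FockR} (hf : f ∈ Delta) :
    ∀ d, ∃ q ∈ Z2, coeff d f = 2 ^ wt d * q := by
  refine Subring.closure_induction ?_ ?_ ?_ ?_ ?_ ?_ hf
  · rintro x (⟨q, hq, rfl⟩ | ⟨k, rfl⟩) d
    · rw [coeff_C]
      split_ifs with h
      · subst h
        exact ⟨q, hq, by simp⟩
      · exact ⟨0, Z2.zero_mem, by simp⟩
    · have : (2 : FockR) ^ k * X k = monomial (Finsupp.single k 1) ((2 : ℚ) ^ k) := by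
        rw [← C_mul_X_eq_monomial, map_pow, C_two']
      rw [this, coeff_monomial]
      split_ifs with h
      · subst h
        exact ⟨1, Z2.one_mem, by simp [wt_single]⟩
      · exact ⟨0, Z2.zero_mem, by simp⟩
  · intro d
    exact ⟨0, Z2.zero_mem, by simp⟩
  · intro d
    rw [coeff_one]
    split_ifs with h
    · subst h
      exact ⟨1, Z2.one_mem, by simp⟩
    · exact ⟨0, Z2.zero_mem, by simp⟩
  · intro x y _ _ hx hy d
    obtain ⟨a, ha, ha'⟩ := hx d
    obtain ⟨b, hb, hb'⟩ := hy d
    exact ⟨a + b, Z2.add_mem ha hb, by rw [coeff_add, ha', hb']; ring⟩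
  · intro x _ hx d
    obtain ⟨a, ha, ha'⟩ := hx d
    exact ⟨-a, Z2.neg_mem ha, by rw [coeff_neg, ha']; ring⟩
  · intro x y _ _ hx hy d
    choose a ha ha' using hx
    choose b hb hb' using hy
    refine ⟨∑ p ∈ Finset.HasAntidiagonal.antidiagonal d, a p.1 * b p.2,
      Z2.sum_mem fun p _ => Z2.mul_mem (ha _) (hb _), ?_⟩
    rw [coeff_mul, Finset.mul_sum]
    refine Finset.sum_congr rfl fun p hp => ?_
    rw [ha', hb', ← Finset.HasAntidiagonal.mem_antidiagonal.1 hp, map_add]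
    ring

lemma C_mem {q : ℚ} (hq : q ∈ Z2) : (C q : FockR) ∈ Delta :=
  Subring.subset_closure (Or.inl ⟨q, hq, rfl⟩)

lemma mon_mem (d : ℕ →₀ ℕ) : (monomial d ((2 : ℚ) ^ wt d) : FockR) ∈ Delta := by
  induction d using Finsupp.induction_linear with
  | zero => simpa using Delta.one_mem
  | add f g hf hg =>
    have := Delta.mul_mem hf hg
    rwa [monomial_mul, ← pow_add, ← map_add] at this
  | single k m =>
    have h : (2 : FockR) ^ k * X k ∈ Delta := Subring.subset_closure (Or.inr ⟨k, rfl⟩)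
    have := Delta.pow_mem h m
    convert this using 1
    rw [wt_single, mul_pow, ← C_mul_X_pow_eq_monomial]
    rw [map_pow, C_two', ← pow_mul, mul_comm k m]

def msExp (s : Multiset ℕ) : ℕ →₀ ℕ :=
  (s.map (fun p => Finsupp.single ((p - 1) / 2) 1)).sum

lemma msExp_apply (s : Multiset ℕ) (hs : ∀ p ∈ s, Odd p) (k : ℕ) :
    msExp s k = s.count (2 * k + 1) := by
  induction s using Multiset.induction with
  | empty => simp [msExp]
  | cons a s ih =>
    have h1 := ih fun p hp => hs p (Multiset.mem_cons_of_mem hp)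
    obtain ⟨j, rfl⟩ := hs a (Multiset.mem_cons_self a s)
    have : msExp ((2 * j + 1) ::ₘ s) = Finsupp.single j 1 + msExp s := by
      simp [msExp]
    rw [this, Finsupp.add_apply, h1, Multiset.count_cons, Finsupp.single_apply]
    by_cases h : j = k
    · simp [h, add_comm]
    · have h' : ¬ (k = j) := fun e => h e.symm
      simp [h, h']

lemma msExp_wt (s : Multiset ℕ) (hs : ∀ p ∈ s, Odd p) :
    2 * wt (msExp s) + Multiset.card s = s.sum := by
  induction s using Multiset.induction with
  | empty => simp [msExp]
  | cons a s ih =>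
    have h1 := ih fun p hp => hs p (Multiset.mem_cons_of_mem hp)
    obtain ⟨j, rfl⟩ := hs a (Multiset.mem_cons_self a s)
    have : msExp ((2 * j + 1) ::ₘ s) = Finsupp.single j 1 + msExp s := by
      simp [msExp]
    rw [this, map_add, wt_single, Multiset.card_cons, Multiset.sum_cons]
    omega

lemma zPart_eq {n : ℕ} (μ : Nat.Partition n) (hs : ∀ p ∈ μ.parts, Odd p) :
    zPart μ = ∏ k ∈ (toExp μ).support,
      ((2 * k + 1 : ℚ) ^ (toExp μ k) * (Nat.factorial (toExp μ k))) := by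
  have he : ∀ k, toExp μ k = μ.parts.count (2 * k + 1) := msExp_apply _ hs
  have : zPart μ = ∏ p ∈ μ.parts.toFinset,
      ((p : ℚ) ^ μ.parts.count p * (Nat.factorial (μ.parts.count p))) := by
    have hm : ∀ t : Multiset ℕ, (do let a ← t; pure (a : ℚ)) = t.map (fun a : ℕ => (a : ℚ)) := by
      intro t
      simp [Multiset.bind_def, Multiset.pure_def, Multiset.bind_singleton]
    rw [Finset.prod, Multiset.toFinset_val, zPart, hm, hm, Multiset.map_map]
    congr 1
    refine Multiset.map_congr rfl fun p _ => ?_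
    simp only [Function.comp]
    rw [Multiset.count_map_eq_count' _ _ Nat.cast_injective]
  rw [this]
  symm
  refine Finset.prod_bij (fun k _ => 2 * k + 1) ?_ ?_ ?_ ?_
  · intro k hk
    rw [Finsupp.mem_support_iff, he] at hk
    simpa [Multiset.count_eq_zero] using hk
  · intro a _ b _ h
    omega
  · intro p hp
    rw [Multiset.mem_toFinset] at hp
    obtain ⟨j, rfl⟩ := hs p hp
    exact ⟨j, by rw [Finsupp.mem_support_iff, he]; simpa [Multiset.count_eq_zero] using hp, rfl⟩
  · intro k _
    rw [he]
    push_cast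
    rfl

lemma nat_mem (m : ℕ) : (m : ℚ) ∈ Z2 := natCast_mem Z2 m

lemma term_mem (n : ℕ) (hn : 1 ≤ n) (f : FockR) (hf : f ∈ Delta) (μ : Nat.Partition n)
    (hs : ∀ p ∈ μ.parts, Odd p) (d : ℕ →₀ ℕ) :
    ∃ g ∈ Delta, ((2 : ℚ) ^ (Multiset.card μ.parts) / zPart μ) •
      ((coeff d f * ∏ k ∈ (toExp μ).support,
        ((2 * k + 1 : ℚ) ^ (toExp μ) k * ((d k).descFactorial ((toExp μ) k)))) •
      monomial (d - toExp μ) (1 : ℚ)) = (2 : FockR) ^ ((n - eps n + 2) / 2) * g := by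
  obtain ⟨q, hq, hq'⟩ := coeff_of_mem hf d
  have hw : 2 * wt (toExp μ) + Multiset.card μ.parts = n := by
    exact (msExp_wt _ hs).trans μ.parts_sum
  have hc : 1 ≤ Multiset.card μ.parts := by
    rw [Nat.one_le_iff_ne_zero]
    intro h
    rw [Multiset.card_eq_zero] at h
    have := μ.parts_sum
    rw [h] at this
    simp at this
    omega
  rw [zPart_eq μ hs]
  set e := toExp μ
  by_cases hle : e ≤ d
  · have hwd : wt d = wt (d - e) + wt e := by
      rw [← map_add, tsub_add_cancel_of_le hle]
    obtain ⟨r, hr⟩ : ∃ r, Multiset.card μ.parts + wt e = (n - eps n + 2) / 2 + r := by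
      apply Nat.exists_eq_add_of_le
      unfold eps
      omega
    have hprod : ∏ k ∈ e.support, ((2 * k + 1 : ℚ) ^ e k * ((d k).descFactorial (e k))) =
        (∏ k ∈ e.support, ((2 * k + 1 : ℚ) ^ e k * (Nat.factorial (e k)))) *
          ((∏ k ∈ e.support, (d k).choose (e k) : ℕ) : ℚ) := by
      push_cast
      rw [← Finset.prod_mul_distrib]
      refine Finset.prod_congr rfl fun k _ => ?_
      rw [Nat.descFactorial_eq_factorial_mul_choose]
      push_cast
      ring
    have hz : (∏ k ∈ e.support, ((2 * k + 1 : ℚ) ^ e k * (Nat.factorial (e k)))) ≠ 0 := by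
      refine Finset.prod_ne_zero_iff.2 fun k _ => ?_
      positivity
    rw [hprod]
    generalize (∏ k ∈ e.support, ((2 * k + 1 : ℚ) ^ e k * (Nat.factorial (e k)))) = z at hz
    generalize (∏ k ∈ e.support, (d k).choose (e k)) = m
    refine ⟨C (((2 ^ r : ℕ) : ℚ) * q * m) * monomial (d - e) ((2 : ℚ) ^ wt (d - e)),
      Delta.mul_mem (C_mem (Z2.mul_mem (Z2.mul_mem (nat_mem _) hq) (nat_mem _))) (mon_mem _), ?_⟩
    have h2 : (2 : FockR) ^ ((n - eps n + 2) / 2) = C ((2 : ℚ) ^ ((n - eps n + 2) / 2)) := by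
      rw [map_pow, C_two']
    rw [h2, C_mul_monomial, C_mul_monomial, smul_monomial, smul_monomial, hq', hwd]
    congr 1
    simp only [smul_eq_mul]
    have h3 : (2 : ℚ) ^ Multiset.card μ.parts * 2 ^ wt e =
        2 ^ ((n - eps n + 2) / 2) * 2 ^ r := by
      rw [← pow_add, hr, pow_add]
    field_simp
    push_cast
    rw [pow_add]
    linear_combination (2 ^ wt (d - e) * q * m) * h3
  · refine ⟨0, Delta.zero_mem, ?_⟩
    obtain ⟨k, hk⟩ : ∃ k, d k < e k := by
      by_contra h
      push Not at h
      exact hle h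
    rw [Finset.prod_eq_zero (f := fun k : ℕ => (2 * k + 1 : ℚ) ^ e k * ((d k).descFactorial (e k) : ℚ))
      (i := k)]
    · simp
    · rw [Finsupp.mem_support_iff]; omega
    · rw [Nat.descFactorial_eq_zero_iff_lt.2 hk]; simp

lemma sum_mem_pow {ι : Type} (s : Finset ι) (F : ι → FockR) (c : FockR)
    (h : ∀ i ∈ s, ∃ g ∈ Delta, F i = c * g) : ∃ g ∈ Delta, ∑ i ∈ s, F i = c * g := by
  choose! g hg hg' using h
  exact ⟨∑ i ∈ s, g i, Delta.sum_mem hg, by rw [Finset.mul_sum]; exact Finset.sum_congr rfl hg'⟩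

/-- For every `n ≥ 1` and `f ∈ Δ`, the element `q_n^*(f)` lies in `2^{(n-ε(n)+2)/2}·Δ`. -/
theorem qstar_maps_Delta (n : ℕ) (hn : 1 ≤ n) (f : FockR) (hf : f ∈ Delta) :
    ∃ g ∈ Delta, qStar n f = (2 : FockR) ^ ((n - eps n + 2) / 2) * g := by
  unfold qStar
  refine sum_mem_pow _ _ _ fun μ hμ => ?_
  unfold pStar
  rw [Finset.smul_sum]
  refine sum_mem_pow _ _ _ fun d _ => ?_
  refine term_mem n hn f hf μ ?_ d
  intro p hp
  simp only [Nat.Partition.odds, Nat.Partition.restricted, Finset.mem_filter] at hμ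
  exact Nat.not_even_iff_odd.1 (hμ.2 p hp)

end
end

section
/- For every f ∈ Δ, the element S(f) := Σ_{n≥1} (−1)^{n+1} q_{n+1}·(q_n^*(f)) (a finite sum, since q_n^*(f) = 0 once n exceeds the degree of f) lies in 4Δ; consequently the operators f₁ := (1/4)·Σ_{n≥1} (−1)^{n+1} q_{n+1} q_n^* and f₀ := p₁ − (1/4)·Σ_{n≥1} (−1)^{n+1} q_{n+1} q_n^* (where p₁ denotes multiplication by p₁) both map Δ into Δ. -/
open MvPolynomial

noncomputable section

/-- `S(f) = Σ_{n ≥ 1} (-1)^{n+1} q_{n+1}·(q_n^*(f))` (a finite sum); here the sum is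
reindexed by `n = m + 1`, so the sign `(-1)^{n+1}` becomes `(-1)^m`. -/
def Sop (f : FockR) : FockR :=
  ∑ᶠ m : ℕ, ((-1 : ℚ) ^ m) • (qFun (m + 2) * qStar (m + 1) f)

/-- 2-adic valuation at least `c`. -/
def V2 (c : ℤ) (q : ℚ) : Prop := padicNorm 2 q ≤ (2 : ℚ) ^ (-c)

lemma V2_zero (c : ℤ) : V2 c 0 := by
  unfold V2
  rw [padicNorm.zero]
  positivity

lemma V2_mono {c c' : ℤ} {q : ℚ} (h : c' ≤ c) (hq : V2 c q) : V2 c' q := by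
  unfold V2 at *
  refine hq.trans ?_
  exact zpow_le_zpow_right₀ (by norm_num) (by omega)

lemma V2_add {c : ℤ} {a b : ℚ} (ha : V2 c a) (hb : V2 c b) : V2 c (a + b) := by
  unfold V2 at *
  exact padicNorm.nonarchimedean.trans (max_le ha hb)

lemma V2_neg {c : ℤ} {a : ℚ} (ha : V2 c a) : V2 c (-a) := by
  unfold V2 at *
  rwa [padicNorm.neg]

lemma V2_mul {c c' : ℤ} {a b : ℚ} (ha : V2 c a) (hb : V2 c' b) : V2 (c + c') (a * b) := by
  unfold V2 at *
  rw [padicNorm.mul, neg_add, zpow_add₀ (by norm_num)]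
  exact mul_le_mul ha hb (padicNorm.nonneg _) (by positivity)

lemma V2_sum {ι : Type*} {c : ℤ} (s : Finset ι) (f : ι → ℚ) (h : ∀ i ∈ s, V2 c (f i)) :
    V2 c (∑ i ∈ s, f i) :=
  Finset.sum_induction f (V2 c) (fun _ _ => V2_add) (V2_zero c) h

lemma V2_int (n : ℤ) : V2 0 (n : ℚ) := by
  unfold V2
  simpa using padicNorm.of_int (p := 2) n

lemma V2_nat (n : ℕ) : V2 0 (n : ℚ) := by
  simpa using V2_int n

lemma V2_prod {ι : Type*} {c : ι → ℤ} (s : Finset ι) (f : ι → ℚ) (h : ∀ i ∈ s, V2 (c i) (f i)) :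
    V2 (∑ i ∈ s, c i) (∏ i ∈ s, f i) := by
  classical
  induction s using Finset.induction_on with
  | empty => simpa using V2_nat 1
  | insert a s ha ih =>
    rw [Finset.sum_insert ha, Finset.prod_insert ha]
    exact V2_mul (h a (by simp)) (ih fun i hi => h i (by simp [hi]))

lemma V2_two_zpow (c : ℤ) : V2 c ((2 : ℚ) ^ c) := by
  unfold V2
  have h2 : padicNorm 2 (2 : ℚ) = 2⁻¹ := by
    simpa using padicNorm.padicNorm_p_of_prime (p := 2)
  have h0 : ((2 : ℚ) ^ c) ≠ 0 := by positivity
  have : padicValRat 2 ((2 : ℚ) ^ c) = c := by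
    have h4 : padicValRat 2 (2 : ℚ) = 1 := by
      simpa using padicValRat.self (p := 2) (by norm_num)
    rw [padicValRat.zpow, h4, mul_one]
  rw [padicNorm.eq_zpow_of_nonzero h0, this]
  norm_num

lemma V2_two_pow (c : ℕ) : V2 c ((2 : ℚ) ^ c) := by
  simpa using V2_two_zpow c

lemma V2_zero_iff (q : ℚ) : V2 0 q ↔ Odd q.den := by
  unfold V2
  have hq : padicNorm 2 q = padicNorm 2 (q.num : ℚ) / padicNorm 2 (q.den : ℚ) := by
    rw [← padicNorm.div, Rat.num_div_den]
  rw [hq]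
  constructor
  · intro h
    by_contra hodd
    have h2 : 2 ∣ q.den := by
      rw [Nat.not_odd_iff_even] at hodd
      exact hodd.two_dvd
    have hn : ¬ ((2 : ℕ) : ℤ) ∣ q.num := by
      intro hd
      have h3 : 2 ∣ q.num.natAbs := by omega
      have := Nat.dvd_gcd h3 h2
      rw [q.reduced.gcd_eq_one] at this
      omega
    have e1 := (padicNorm.int_eq_one_iff (p := 2) q.num).2 hn
    have e2 := (padicNorm.nat_lt_one_iff (p := 2) q.den).2 h2
    have e3 : 0 < padicNorm 2 (q.den : ℚ) := by
      refine lt_of_le_of_ne (padicNorm.nonneg _) (Ne.symm (padicNorm.nonzero ?_))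
      exact_mod_cast q.den_nz
    rw [e1, div_le_iff₀ e3] at h
    simp only [neg_zero, zpow_zero, one_mul] at h
    linarith
  · intro h
    have e2 := (padicNorm.nat_eq_one_iff (p := 2) q.den).2 (by
      intro h2
      rw [← Nat.not_even_iff_odd] at h
      exact h (even_iff_two_dvd.2 h2))
    rw [e2, div_one]
    simpa using padicNorm.of_int (p := 2) q.num

lemma V2_fac (k m : ℕ) (hm : m ≠ 0) :
    V2 1 ((2 : ℚ) ^ m / ((2 * k + 1 : ℚ) ^ m * (Nat.factorial m))) := by
  unfold V2
  have h1 : padicNorm 2 (2 * k + 1 : ℚ) = 1 := by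
    have := (padicNorm.nat_eq_one_iff (p := 2) (2 * k + 1)).2 (by omega)
    exact_mod_cast this
  have h0 : ((2 : ℚ) ^ m / ((2 * k + 1 : ℚ) ^ m * (Nat.factorial m))) ≠ 0 := by positivity
  rw [padicNorm.eq_zpow_of_nonzero h0]
  have hk : (2 * k + 1 : ℚ) ≠ 0 := by positivity
  have h3 : padicValRat 2 (2 * k + 1 : ℚ) = 0 := by
    have : padicValNat 2 (2 * k + 1) = 0 := padicValNat.eq_zero_of_not_dvd (by omega)
    have h := padicValRat.of_nat (p := 2) (n := 2 * k + 1)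
    rw [this] at h
    exact_mod_cast h
  have h4 : padicValRat 2 (2 : ℚ) = 1 := by
    simpa using padicValRat.self (p := 2) (by norm_num)
  have h6 := padicValRat.of_nat (p := 2) (n := Nat.factorial m)
  have h5 := padicValNat_factorial_lt_of_ne_zero 2 hm
  have hf : ((Nat.factorial m : ℕ) : ℚ) ≠ 0 := by positivity
  rw [padicValRat.div (by positivity) (by positivity),
    padicValRat.mul (by positivity) hf, padicValRat.pow, padicValRat.pow,
    padicValRat.of_nat, h3, h4]
  push_cast
  exact zpow_le_zpow_right₀ (by norm_num) (by omega)

/-- filtration -/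
def PF (c : ℤ) (f : FockR) : Prop := ∀ d, V2 (c + wt d) (coeff d f)

lemma PF_zero (c : ℤ) : PF c 0 := fun d => by simpa using V2_zero _

lemma PF_add {c : ℤ} {f g : FockR} (hf : PF c f) (hg : PF c g) : PF c (f + g) := fun d => by
  rw [coeff_add]; exact V2_add (hf d) (hg d)

lemma PF_neg {c : ℤ} {f : FockR} (hf : PF c f) : PF c (-f) := fun d => by
  rw [coeff_neg]; exact V2_neg (hf d)

lemma PF_sum {ι : Type*} {c : ℤ} (s : Finset ι) (f : ι → FockR) (h : ∀ i ∈ s, PF c (f i)) :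
    PF c (∑ i ∈ s, f i) :=
  Finset.sum_induction f (PF c) (fun _ _ => PF_add) (PF_zero c) h

lemma PF_mul {c c' : ℤ} {f g : FockR} (hf : PF c f) (hg : PF c' g) : PF (c + c') (f * g) := by
  intro d
  rw [coeff_mul]
  refine V2_sum _ _ fun x hx => ?_
  have := V2_mul (hf x.1) (hg x.2)
  refine V2_mono (le_of_eq ?_) this
  rw [← Finset.HasAntidiagonal.mem_antidiagonal.1 hx, map_add]
  push_cast
  ring

lemma PF_smul {c c' : ℤ} {q : ℚ} {f : FockR} (hq : V2 c q) (hf : PF c' f) :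
    PF (c + c') (q • f) := by
  intro d
  rw [coeff_smul, smul_eq_mul, add_assoc]
  exact V2_mul hq (hf d)

lemma PF_monomial {c : ℤ} {e : ℕ →₀ ℕ} {q : ℚ} (h : V2 (c + wt e) q) :
    PF c (monomial e q) := by
  intro d
  rw [coeff_monomial]
  split_ifs with hd
  · rwa [← hd]
  · exact V2_zero _

lemma PF_of_mem {f : FockR} (hf : f ∈ Delta) : PF 0 f := by
  unfold Delta at hf
  induction hf using Subring.closure_induction with
  | mem x hx =>
    rcases hx with ⟨q, hq, rfl⟩ | ⟨k, rfl⟩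
    · exact PF_monomial (by simpa using (V2_zero_iff q).2 hq)
    · have : (2 : FockR) ^ k * X k = monomial (Finsupp.single k 1) ((2 : ℚ) ^ k) := by
        have h2 : (2 : FockR) = C 2 := (map_ofNat C 2).symm
        rw [h2, ← C_pow, C_mul_X_eq_monomial]
      rw [this]
      apply PF_monomial
      rw [wt_single]
      simpa using V2_two_pow k
  | zero => exact PF_zero 0
  | one => exact PF_monomial (by simpa using V2_nat 1)
  | add x y _ _ hx hy => exact PF_add hx hy
  | neg x _ hx => exact PF_neg hx
  | mul x y _ _ hx hy => simpa using PF_mul hx hy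

lemma mono_mem (d : ℕ →₀ ℕ) : monomial d ((2 : ℚ) ^ wt d) ∈ Delta := by
  induction d using Finsupp.induction_linear with
  | zero => simp
  | add f g hf hg =>
    have := mul_mem hf hg
    rwa [monomial_mul, ← pow_add, ← map_add] at this
  | single k m =>
    have h : (2 : FockR) ^ k * X k ∈ Delta := Subring.subset_closure (Or.inr ⟨k, rfl⟩)
    have h2 : (2 : FockR) = C 2 := (map_ofNat C 2).symm
    have := pow_mem h m
    rwa [mul_pow, ← pow_mul, h2, ← C_pow, C_mul_X_pow_eq_monomial, mul_comm k m,
      ← wt_single] at this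

lemma mem_of_PF {f : FockR} (hf : PF 0 f) : f ∈ Delta := by
  rw [f.as_sum]
  refine sum_mem fun d _ => ?_
  have h1 : C (coeff d f * (2 : ℚ) ^ (-(wt d : ℤ))) ∈ Delta := by
    refine Subring.subset_closure (Or.inl ⟨_, ?_, rfl⟩)
    rw [← V2_zero_iff]
    simpa using V2_mul (hf d) (V2_two_zpow (-(wt d : ℤ)))
  have := mul_mem h1 (mono_mem d)
  rw [C_mul_monomial] at this
  convert this using 2
  rw [zpow_neg, zpow_natCast]
  field_simp

/-- exponent of a multiset -/
def mexp (s : Multiset ℕ) : ℕ →₀ ℕ := (s.map (fun p => Finsupp.single ((p - 1) / 2) 1)).sum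

lemma mexp_apply (s : Multiset ℕ) (hs : ∀ p ∈ s, Odd p) (k : ℕ) :
    mexp s k = s.count (2 * k + 1) := by
  induction s using Multiset.induction_on with
  | empty => simp [mexp]
  | cons a s ih =>
    have ha : Odd a := hs a (by simp)
    have := ih (fun p hp => hs p (by simp [hp]))
    have e : mexp (a ::ₘ s) = Finsupp.single ((a - 1) / 2) 1 + mexp s := by simp [mexp]
    rw [e, Finsupp.add_apply, this, Multiset.count_cons, Finsupp.single_apply, add_comm]
    obtain ⟨b, rfl⟩ := ha
    congr 1
    have : (2 * b + 1 - 1) / 2 = b := by omega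
    rw [this]
    by_cases h : b = k
    · simp [h]
    · rw [if_neg h, if_neg (by omega)]

lemma mexp_wt (s : Multiset ℕ) (hs : ∀ p ∈ s, Odd p) :
    s.sum = 2 * wt (mexp s) + Multiset.card s := by
  induction s using Multiset.induction_on with
  | empty => simp [mexp]
  | cons a s ih =>
    have ha : Odd a := hs a (by simp)
    have := ih (fun p hp => hs p (by simp [hp]))
    have e : mexp (a ::ₘ s) = Finsupp.single ((a - 1) / 2) 1 + mexp s := by simp [mexp]
    rw [e, map_add, Multiset.sum_cons, Multiset.card_cons, wt_single, this]
    obtain ⟨b, rfl⟩ := ha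
    omega

lemma mexp_deg (s : Multiset ℕ) : ∑ k ∈ (mexp s).support, mexp s k = Multiset.card s := by
  change (mexp s).degree = _
  induction s using Multiset.induction_on with
  | empty => simp [mexp]
  | cons a s ih =>
    have e : mexp (a ::ₘ s) = Finsupp.single ((a - 1) / 2) 1 + mexp s := by simp [mexp]
    rw [e, map_add, ih, Multiset.card_cons, Finsupp.degree_single, add_comm]

lemma odd_parts {n : ℕ} {μ : Nat.Partition n} (h : μ ∈ Nat.Partition.odds n) :
    ∀ p ∈ μ.parts, Odd p := by
  intro p hp
  simp only [Nat.Partition.odds, Nat.Partition.restricted, Finset.mem_filter] at h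
  simpa using h.2 p hp

lemma zPart_eq_s7 {n : ℕ} {μ : Nat.Partition n} (h : μ ∈ Nat.Partition.odds n) :
    zPart μ = zExp (toExp μ) := by
  have ho := odd_parts h
  have hap : ∀ k, toExp μ k = μ.parts.count (2 * k + 1) := mexp_apply _ ho
  have hb : ∀ s : Multiset ℕ, (do let a ← s; pure (a : ℚ)) =
      Multiset.map (Nat.cast : ℕ → ℚ) s := by
    intro s
    simp only [Multiset.bind_def, Multiset.pure_def, Multiset.bind_singleton]
  unfold zPart zExp
  simp only [hb, Multiset.map_map, Function.comp_def,
    Multiset.count_map_eq_count' (Nat.cast : ℕ → ℚ) _ Nat.cast_injective]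
  change ∏ k ∈ μ.parts.toFinset, ((k : ℚ) ^ μ.parts.count k *
    (Nat.factorial (μ.parts.count k))) = _
  symm
  refine Finset.prod_nbij' (fun k => 2 * k + 1) (fun p => (p - 1) / 2) ?_ ?_ ?_ ?_ ?_
  · intro k hk
    rw [Finsupp.mem_support_iff, hap] at hk
    simpa using Multiset.count_ne_zero.1 hk
  · intro p hp
    rw [Multiset.mem_toFinset] at hp
    obtain ⟨b, rfl⟩ := ho p hp
    have : (2 * b + 1 - 1) / 2 = b := by omega
    rw [Finsupp.mem_support_iff, hap, this]
    exact Multiset.count_ne_zero.2 hp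
  · intro k _
    change (2 * k + 1 - 1) / 2 = k
    omega
  · intro p hp
    rw [Multiset.mem_toFinset] at hp
    obtain ⟨b, rfl⟩ := ho p hp
    change 2 * ((2 * b + 1 - 1) / 2) + 1 = 2 * b + 1
    omega
  · intro k _
    rw [hap]
    push_cast
    rfl

lemma coef_eq {n : ℕ} {μ : Nat.Partition n} (h : μ ∈ Nat.Partition.odds n) :
    (2 : ℚ) ^ (Multiset.card μ.parts) / zPart μ = ∏ k ∈ (toExp μ).support,
      ((2 : ℚ) ^ (toExp μ k) / ((2 * k + 1 : ℚ) ^ (toExp μ k) *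
        (Nat.factorial (toExp μ k)))) := by
  rw [zPart_eq_s7 h, zExp, Finset.prod_div_distrib, Finset.prod_pow_eq_pow_sum]
  congr 2
  exact (mexp_deg _).symm

lemma part_facts {n : ℕ} (hn : n ≠ 0) {μ : Nat.Partition n} (h : μ ∈ Nat.Partition.odds n) :
    n = 2 * wt (toExp μ) + Multiset.card μ.parts ∧ 1 ≤ Multiset.card μ.parts := by
  have h1 := mexp_wt μ.parts (odd_parts h)
  rw [μ.parts_sum] at h1
  refine ⟨h1, ?_⟩
  rw [Nat.one_le_iff_ne_zero]
  intro h0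
  rw [Multiset.card_eq_zero] at h0
  have := μ.parts_sum
  rw [h0] at this
  exact hn (by simpa using this.symm)

lemma qFun_PF (n : ℕ) : PF (1 - (n / 2 : ℕ)) (qFun (n + 1)) := by
  unfold qFun
  refine PF_sum _ _ fun μ hμ => ?_
  obtain ⟨h1, h2⟩ := part_facts (by omega) hμ
  have hd : ∑ k ∈ (toExp μ).support, toExp μ k = Multiset.card μ.parts := mexp_deg _
  rw [pMu, smul_monomial]
  apply PF_monomial
  rw [smul_eq_mul, mul_one, coef_eq hμ]
  have := V2_prod (c := fun _ => 1) (toExp μ).support (fun k => ((2 : ℚ) ^ (toExp μ k) /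
    ((2 * k + 1 : ℚ) ^ (toExp μ k) * (Nat.factorial (toExp μ k)))))
    (fun k hk => V2_fac k _ (Finsupp.mem_support_iff.1 hk))
  refine V2_mono ?_ this
  have hne : (toExp μ).support.card ≠ 0 := by
    intro h0
    rw [Finset.card_eq_zero] at h0
    rw [h0] at hd
    simp only [Finset.sum_empty] at hd
    omega
  simp only [Finset.sum_const, nsmul_eq_mul, mul_one]
  omega

lemma qStar_PF (n : ℕ) (hn : n ≠ 0) {f : FockR} (hf : PF 0 f) :
    PF (1 + (n / 2 : ℕ)) (qStar n f) := by
  unfold qStar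
  refine PF_sum _ _ fun μ hμ => ?_
  obtain ⟨h1, h2⟩ := part_facts hn hμ
  have hd : ∑ k ∈ (toExp μ).support, toExp μ k = Multiset.card μ.parts := mexp_deg _
  rw [pStar, Finset.smul_sum]
  refine PF_sum _ _ fun d _ => ?_
  rw [smul_smul, smul_monomial]
  apply PF_monomial
  rw [smul_eq_mul, mul_one, coef_eq hμ, mul_left_comm, ← Finset.prod_mul_distrib]
  have key : ∏ k ∈ (toExp μ).support,
      ((2 : ℚ) ^ (toExp μ k) / ((2 * k + 1 : ℚ) ^ (toExp μ k) *
        (Nat.factorial (toExp μ k))) *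
        ((2 * k + 1 : ℚ) ^ (toExp μ k) * ((d k).descFactorial (toExp μ k)))) =
      ∏ k ∈ (toExp μ).support, ((2 : ℚ) ^ (toExp μ k) * ((d k).choose (toExp μ k) : ℕ)) := by
    refine Finset.prod_congr rfl fun k _ => ?_
    rw [Nat.descFactorial_eq_factorial_mul_choose]
    have hk : (2 * k + 1 : ℚ) ≠ 0 := by positivity
    have hfa : ((Nat.factorial (toExp μ k) : ℕ) : ℚ) ≠ 0 := by positivity
    push_cast
    field_simp
  rw [key]
  by_cases hle : toExp μ ≤ d
  · have hV := V2_prod (c := fun k => ((toExp μ k : ℕ) : ℤ)) (toExp μ).support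
      (fun k => ((2 : ℚ) ^ (toExp μ k) * ((d k).choose (toExp μ k) : ℕ)))
      (fun k _ => by simpa using V2_mul (V2_two_pow (toExp μ k)) (V2_nat _))
    refine V2_mono ?_ (V2_mul (hf d) hV)
    have hw : wt d = wt (d - toExp μ) + wt (toExp μ) := by
      rw [← map_add, tsub_add_cancel_of_le hle]
    rw [← Nat.cast_sum, hd, hw]
    push_cast
    omega
  · have : ∃ k, d k < toExp μ k := by
      by_contra hc
      push Not at hc
      exact hle hc
    obtain ⟨k, hk⟩ := this
    rw [Finset.prod_eq_zero (i := k), mul_zero]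
    · exact V2_zero _
    · rw [Finsupp.mem_support_iff]; omega
    · rw [Nat.choose_eq_zero_of_lt hk]; simp

lemma Sop_PF {f : FockR} (hf : PF 0 f) : PF 2 (Sop f) := by
  unfold Sop
  refine finsum_induction (PF 2) (PF_zero 2) (fun _ _ => PF_add) fun m => ?_
  have h := PF_mul (qFun_PF (m + 1)) (qStar_PF (m + 1) (by omega) hf)
  have hs : V2 0 ((-1 : ℚ) ^ m) := by simpa using V2_int ((-1) ^ m)
  have := PF_smul hs h
  convert this using 1
  ring

/-- For every `f ∈ Δ`, `S(f)` lies in `4Δ`; consequently the operators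
`f₁ = (1/4)Σ_{n≥1}(-1)^{n+1} q_{n+1} q_n^*` and
`f₀ = p₁ - (1/4)Σ_{n≥1}(-1)^{n+1} q_{n+1} q_n^*` both map `Δ` into `Δ`. -/
theorem f0_f1_preserve_Delta (f : FockR) (hf : f ∈ Delta) :
    (∃ g ∈ Delta, Sop f = 4 * g) ∧
    (1 / 4 : ℚ) • Sop f ∈ Delta ∧
    X 0 * f - (1 / 4 : ℚ) • Sop f ∈ Delta := by
  have h := Sop_PF (PF_of_mem hf)
  have h4 : (1 / 4 : ℚ) • Sop f ∈ Delta := by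
    apply mem_of_PF
    have hq : V2 (-2) (1 / 4 : ℚ) := by
      have := V2_two_zpow (-2)
      norm_num at this ⊢
      exact this
    simpa using PF_smul hq h
  have hX : X 0 ∈ Delta := Subring.subset_closure (Or.inr ⟨0, by simp⟩)
  refine ⟨⟨_, h4, ?_⟩, h4, sub_mem (mul_mem hX hf) h4⟩
  have : (4 : FockR) = C 4 := (map_ofNat C 4).symm
  rw [this, ← smul_eq_C_mul, smul_smul]
  norm_num

end
end
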